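/- Davenport–Schmidt theorem on approximation by cubic algebraic integers: Let ξ be a real number which is neither rational nor a quadratic irrational, and let γ = (1+√5)/2. Then there is a constant c > 0 such that there are infinitely many real algebraic integers α of degree at most 3 satisfying 0 < |ξ − α| ≤ c · H(α)^{−γ−1}. -/

import Mathlib

/-- The (usual) height of an integer polynomial: the maximum of the absolute
values of its coefficients. -/
noncomputable def intPolyHeight (f : Polynomial ℤ) : ℕ :=
  (Finset.range (f.natDegree + 1)).sup fun i => (f.coeff i).natAbs

/-- `P` is the minimal polynomial over `ℤ` of the real algebraic number `α`:
a primitive integer polynomial with positive leading coefficient, vanishing at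
`α`, of minimal degree among nonzero integer polynomials vanishing at `α`. -/
def IsMinIntPoly (α : ℝ) (P : Polynomial ℤ) : Prop :=
  P ≠ 0 ∧ 0 < P.leadingCoeff ∧ P.content = 1 ∧ Polynomial.aeval α P = 0 ∧
    ∀ Q : Polynomial ℤ, Q ≠ 0 → Polynomial.aeval α Q = 0 → P.natDegree ≤ Q.natDegree

section Transference

open Module Submodule
open scoped RealInnerProductSpace

variable {E : Type} [NormedAddCommGroup E] [InnerProductSpace ℝ E]

/-- Orthogonal projection along `v`, together with reduction modulo integer multiples of `v`. -/
lemma exists_projection_reduction {v : E} (hv : v ≠ 0) :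
    ∃ π : E →ₗ[ℝ] (ℝ ∙ v)ᗮ, π v = 0 ∧ (∀ x (y : (ℝ ∙ v)ᗮ), ⟪π x, y⟫ = ⟪x, (y : E)⟫) ∧
      ∀ x, ∃ k : ℤ, ‖x - k • v‖ ^ 2 ≤ ‖π x‖ ^ 2 + ‖v‖ ^ 2 / 4 := by
  have hv2 : ‖v‖ ^ 2 ≠ 0 := by simpa using hv
  have hperp : ∀ x : E, x - (⟪v, x⟫ / ‖v‖ ^ 2) • v ∈ (ℝ ∙ v)ᗮ := by
    intro x
    rw [mem_orthogonal_singleton_iff_inner_right, inner_sub_right, inner_smul_right,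
      real_inner_self_eq_norm_sq]
    field_simp
    ring
  let π : E →ₗ[ℝ] (ℝ ∙ v)ᗮ := LinearMap.codRestrict _
    { toFun := fun x => x - (⟪v, x⟫ / ‖v‖ ^ 2) • v
      map_add' := fun x y => by rw [inner_add_right, add_div, add_smul]; abel
      map_smul' := fun c x => by
        rw [inner_smul_right, mul_div_assoc, mul_smul, RingHom.id_apply, smul_sub] } hperp
  have hπ : ∀ x, (π x : E) = x - (⟪v, x⟫ / ‖v‖ ^ 2) • v := fun x => rfl
  have horth : ∀ y : (ℝ ∙ v)ᗮ, ⟪v, (y : E)⟫ = 0 := fun y =>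
    mem_orthogonal_singleton_iff_inner_right.1 y.2
  refine ⟨π, ?_, ?_, ?_⟩
  · apply Subtype.ext
    rw [hπ, real_inner_self_eq_norm_sq, div_self hv2]
    simp
  · intro x y
    rw [coe_inner, hπ, inner_sub_left, inner_smul_left, horth]
    simp
  · intro x
    set s := ⟪v, x⟫ / ‖v‖ ^ 2 with hs
    refine ⟨round s, ?_⟩
    have hx : x - round s • v = (π x : E) + (s - round s) • v := by
      rw [hπ, ← hs, sub_smul, Int.cast_smul_eq_zsmul]
      abel
    rw [hx, norm_add_sq_real, inner_smul_right, real_inner_comm, horth, norm_smul, mul_pow,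
      Real.norm_eq_abs, sq_abs, coe_norm]
    have h1 := abs_sub_round s
    have h2 : (s - round s) ^ 2 ≤ 1 / 4 := by
      rw [← sq_abs]
      nlinarith [abs_nonneg (s - round s)]
    nlinarith [sq_nonneg ‖v‖]

/-- A subgroup all of whose nonzero vectors are long admits a short nonzero vector having integer
inner product with each of its elements. -/
lemma exists_short_dual_vector {ρ : ℝ} (hρ : 0 < ρ) (n : ℕ) :
    ∃ R : ℝ, 0 < R ∧ ∀ (E : Type) [NormedAddCommGroup E] [InnerProductSpace ℝ E]
      (_ : finrank ℝ E = n + 1) (G : AddSubgroup E), (∀ x ∈ G, x ≠ 0 → R ≤ ‖x‖) →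
      ∃ y : E, y ≠ 0 ∧ ‖y‖ < ρ ∧ ∀ x ∈ G, ∃ k : ℤ, ⟪x, y⟫ = k := by
  have key : ∀ R : ℝ, 0 < R → ∀ (E : Type) [NormedAddCommGroup E] [InnerProductSpace ℝ E]
      (m : ℕ) (_ : finrank ℝ E = m + 1) (G : AddSubgroup E), (∀ x ∈ G, x ≠ 0 → R ≤ ‖x‖) →
      (∃ y : E, y ≠ 0 ∧ ‖y‖ < ρ ∧ ∀ x ∈ G, ∃ k : ℤ, ⟪x, y⟫ = k) ∨
      ∃ v ∈ G, v ≠ 0 ∧ ∀ x ∈ G, x ≠ 0 → ‖v‖ ≤ 7 / 5 * ‖x‖ := by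
    intro R hR E _ _ m hE G hG
    by_cases hbot : ∃ x ∈ G, x ≠ 0
    · right
      let S : Set ℝ := norm '' {x | x ∈ G ∧ x ≠ 0}
      have hne : S.Nonempty := by
        obtain ⟨x, hx⟩ := hbot
        exact ⟨_, x, hx, rfl⟩
      have hlow : ∀ s ∈ S, R ≤ s := by
        rintro _ ⟨x, hx, rfl⟩
        exact hG x hx.1 hx.2
      have hm : R ≤ sInf S := le_csInf hne hlow
      obtain ⟨_, ⟨v, hv, rfl⟩, hlt⟩ := exists_lt_of_csInf_lt hne
        (show sInf S < 7 / 5 * sInf S by linarith)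
      refine ⟨v, hv.1, hv.2, fun x hx hx0 => ?_⟩
      have := csInf_le ⟨R, hlow⟩ (show ‖x‖ ∈ S from ⟨x, ⟨hx, hx0⟩, rfl⟩)
      linarith
    · left
      push Not at hbot
      have : Nontrivial E := nontrivial_of_finrank_pos (R := ℝ) (by omega)
      obtain ⟨y, hy⟩ := exists_norm_eq E (show (0 : ℝ) ≤ ρ / 2 by positivity)
      refine ⟨y, ?_, by linarith, fun x hx => ⟨0, by simp [hbot x hx]⟩⟩
      rw [← norm_pos_iff]
      linarith
  induction n with
  | zero =>
    refine ⟨2 / ρ, by positivity, fun E _ _ hE G hG => ?_⟩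
    rcases key _ (by positivity) E 0 hE G hG with h | ⟨v, hvG, hv, hmin⟩
    · exact h
    have hv0 : 0 < ‖v‖ := norm_pos_iff.2 hv
    obtain ⟨π, -, -, hred⟩ := exists_projection_reduction hv
    have : Fact (finrank ℝ E = 0 + 1) := ⟨hE⟩
    have hE' : finrank ℝ (ℝ ∙ v)ᗮ = 0 := finrank_orthogonal_span_singleton hv
    have : FiniteDimensional ℝ E := FiniteDimensional.of_finrank_pos (by omega)
    have := finrank_zero_iff.1 hE'
    refine ⟨(‖v‖ ^ 2)⁻¹ • v, by simp [hv], ?_, fun x hx => ?_⟩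
    · have h := hG v hvG hv
      rw [norm_smul, norm_inv, norm_pow, norm_norm]
      have h2 : (‖v‖ ^ 2)⁻¹ * ‖v‖ = ‖v‖⁻¹ := by field_simp
      rw [h2, inv_lt_comm₀ hv0 hρ]
      have : 2 / ρ = 2 * ρ⁻¹ := rfl
      have := inv_pos.2 hρ
      linarith
    · obtain ⟨k, hk⟩ := hred x
      have hz : π x = 0 := Subsingleton.elim _ _
      rw [hz, norm_zero] at hk
      have hxk : x - k • v = 0 := by
        by_contra hne
        have := hmin _ (G.sub_mem hx (G.zsmul_mem hvG k)) hne
        nlinarith [norm_nonneg (x - k • v)]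
      refine ⟨k, ?_⟩
      rw [sub_eq_zero.1 hxk, inner_smul_right, ← Int.cast_smul_eq_zsmul ℝ, real_inner_smul_left,
        real_inner_self_eq_norm_sq]
      field_simp
  | succ n ih =>
    obtain ⟨R, hR, ih⟩ := ih
    refine ⟨2 * R, by positivity, fun E _ _ hE G hG => ?_⟩
    rcases key _ (by positivity) E (n + 1) hE G hG with h | ⟨v, hvG, hv, hmin⟩
    · exact h
    obtain ⟨π, hπv, hπ, hred⟩ := exists_projection_reduction hv
    have : Fact (finrank ℝ E = n + 1 + 1) := ⟨hE⟩
    obtain ⟨y, hy0, hyρ, hy⟩ := ih (ℝ ∙ v)ᗮ (finrank_orthogonal_span_singleton hv)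
      (G.map π.toAddMonoidHom) (by
        rintro _ ⟨x, hx, rfl⟩ hne
        simp only [LinearMap.toAddMonoidHom_coe] at hne ⊢
        obtain ⟨k, hk⟩ := hred x
        have hne' : x - k • v ≠ 0 := fun h => hne (by
          rw [sub_eq_zero.1 h, map_zsmul, hπv, smul_zero])
        have hmem := G.sub_mem hx (G.zsmul_mem hvG k)
        have h1 := hmin _ hmem hne'
        have h2 := hG _ hmem hne'
        nlinarith [norm_nonneg (π x), norm_nonneg v])
    refine ⟨y, by simpa using hy0, by simpa using hyρ, fun x hx => ?_⟩
    obtain ⟨k, hk⟩ := hy (π x) ⟨x, hx, rfl⟩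
    exact ⟨k, by rw [← hk, hπ]⟩

/-- A transference principle: if no short nonzero vector has integer inner product with each element
of a subgroup, then this subgroup comes within bounded distance of every vector. -/
lemma exists_covering_radius {r : ℝ} (hr : 0 < r) (n : ℕ) :
    ∃ C : ℝ, 0 < C ∧ ∀ (E : Type) [NormedAddCommGroup E] [InnerProductSpace ℝ E]
      [FiniteDimensional ℝ E] (_ : finrank ℝ E = n) (G : AddSubgroup E),
      (∀ y : E, y ≠ 0 → (∀ x ∈ G, ∃ k : ℤ, ⟪x, y⟫ = k) → r ≤ ‖y‖) →
      ∀ t : E, ∃ x ∈ G, ‖t - x‖ ≤ C := by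
  induction n with
  | zero =>
    refine ⟨1, one_pos, fun E _ _ _ hE G hG t => ⟨0, G.zero_mem, ?_⟩⟩
    have := finrank_zero_iff.1 hE
    rw [Subsingleton.elim t 0]
    simp
  | succ n ih =>
    obtain ⟨C, hC, ih⟩ := ih
    obtain ⟨R, hR, hdual⟩ := exists_short_dual_vector hr n
    refine ⟨C + R, by positivity, fun E _ _ _ hE G hG t => ?_⟩
    obtain ⟨v, hvG, hv, hvR⟩ : ∃ v ∈ G, v ≠ 0 ∧ ‖v‖ < R := by
      by_contra! h
      obtain ⟨y, hy0, hyr, hy⟩ := hdual E hE G h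
      exact absurd (hG y hy0 hy) (not_le.2 hyr)
    obtain ⟨π, -, hπ, hred⟩ := exists_projection_reduction hv
    have : Fact (finrank ℝ E = n + 1) := ⟨hE⟩
    obtain ⟨_, ⟨x, hx, rfl⟩, hxC⟩ := ih (ℝ ∙ v)ᗮ (finrank_orthogonal_span_singleton hv)
      (G.map π.toAddMonoidHom) (by
        intro y hy0 hy
        refine hG y (by simpa using hy0) fun x hx => ?_
        obtain ⟨k, hk⟩ := hy (π x) ⟨x, hx, rfl⟩
        exact ⟨k, by rw [← hk, hπ]⟩) (π t)
    rw [LinearMap.toAddMonoidHom_coe, ← map_sub] at hxC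
    obtain ⟨k, hk⟩ := hred (t - x)
    refine ⟨x + k • v, G.add_mem hx (G.zsmul_mem hvG k), ?_⟩
    rw [← sub_sub]
    refine abs_le_of_sq_le_sq' ?_ (by positivity) |>.2
    nlinarith [norm_nonneg (π (t - x)), norm_nonneg v]

end Transference

section SimultaneousApproximation

/-- The common distance of `nξ` and `nξ²` to their nearest integers. -/
noncomputable def distNearestInt (ξ : ℝ) (n : ℕ) : ℝ :=
  max |(round (n * ξ) : ℝ) - n * ξ| |(round (n * ξ ^ 2) : ℝ) - n * ξ ^ 2|

lemma distNearestInt_le (ξ : ℝ) (x₀ x₁ x₂ : ℤ) :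
    distNearestInt ξ x₀.natAbs ≤ |(x₁ : ℝ) - x₀ * ξ| ∨
      distNearestInt ξ x₀.natAbs ≤ |(x₂ : ℝ) - x₀ * ξ ^ 2| := by
  have hround : ∀ (z : ℝ) (x : ℤ),
      |(round ((x₀.natAbs : ℝ) * z) : ℝ) - x₀.natAbs * z| ≤ |(x : ℝ) - x₀ * z| := by
    intro z x
    rw [abs_sub_comm, Nat.cast_natAbs, Int.cast_abs]
    rcases abs_choice (x₀ : ℝ) with h | h <;> rw [h]
    · rw [abs_sub_comm (x : ℝ)]
      exact round_le _ _
    · refine (round_le (-(x₀ : ℝ) * z) (-x)).trans_eq ?_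
      push_cast
      congr 1
      ring
  rw [distNearestInt]
  rcases max_choice |(round ((x₀.natAbs : ℝ) * ξ) : ℝ) - x₀.natAbs * ξ|
    |(round ((x₀.natAbs : ℝ) * ξ ^ 2) : ℝ) - x₀.natAbs * ξ ^ 2| with h | h <;> rw [h]
  · exact Or.inl (hround _ _)
  · exact Or.inr (hround _ _)

/-- The sequence of record indices of a positive sequence having arbitrarily small values. -/
lemma exists_record_sequence {f : ℕ → ℝ} (hpos : ∀ n, 1 ≤ n → 0 < f n)
    (hsmall : ∀ ε, 0 < ε → ∃ n, 1 ≤ n ∧ f n < ε) :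
    ∃ q : ℕ → ℕ, StrictMono q ∧ (∀ i, 1 ≤ q i) ∧ (∀ i, f (q (i + 1)) < f (q i)) ∧
      ∀ i m, 1 ≤ m → m < q (i + 1) → f (q i) ≤ f m := by
  classical
  let S := {q : ℕ // 1 ≤ q ∧ ∀ m, 1 ≤ m → m < q → f q < f m}
  have step : ∀ s : S, ∃ s' : S, s.1 < s'.1 ∧ f s'.1 < f s.1 ∧
      ∀ m, 1 ≤ m → m < s'.1 → f s.1 ≤ f m := by
    rintro ⟨q, hq1, hq⟩
    have hex := hsmall (f q) (hpos q hq1)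
    obtain ⟨h1, h2⟩ := Nat.find_spec hex
    have h3 : ∀ m, 1 ≤ m → m < Nat.find hex → f q ≤ f m := fun m hm hlt => by
      have := Nat.find_min hex hlt
      push Not at this
      exact this hm
    refine ⟨⟨Nat.find hex, h1, fun m hm hlt => h2.trans_le (h3 m hm hlt)⟩, ?_, h2, h3⟩
    by_contra! hle
    rcases hle.lt_or_eq with hlt | heq
    · exact absurd (hq _ h1 hlt) (not_lt.2 h2.le)
    · simp only at heq
      rw [heq] at h2
      exact lt_irrefl _ h2
  choose next hlt hf hmin using step
  let s : ℕ → S := fun i => Nat.rec ⟨1, le_rfl, fun m h1 h2 => by omega⟩ (fun _ t => next t) i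
  have hs : ∀ i, s (i + 1) = next (s i) := fun i => rfl
  refine ⟨fun i => (s i).1, strictMono_nat_of_lt_succ fun i => ?_, fun i => (s i).2.1,
    fun i => ?_, fun i m => ?_⟩
  · rw [hs]
    exact hlt _
  · simp only [hs]
    exact hf _
  · simp only [hs]
    exact hmin _ m

variable {ξ : ℝ}

lemma abs_mul_sub_mul_sq_le {x₀ x₁ x₂ : ℤ} {l : ℝ} (hx : 1 ≤ x₀) (hl : l ≤ 1)
    (h₁ : |(x₁ : ℝ) - x₀ * ξ| ≤ l) (h₂ : |(x₂ : ℝ) - x₀ * ξ ^ 2| ≤ l) :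
    |((x₀ * x₂ - x₁ ^ 2 : ℤ) : ℝ)| ≤ (2 + 2 * |ξ|) * x₀ * l := by
  have hx' : (1 : ℝ) ≤ x₀ := by exact_mod_cast hx
  have hl0 : 0 ≤ l := (abs_nonneg _).trans h₁
  set e₁ := (x₁ : ℝ) - x₀ * ξ with he₁
  set e₂ := (x₂ : ℝ) - x₀ * ξ ^ 2 with he₂
  have heq : ((x₀ * x₂ - x₁ ^ 2 : ℤ) : ℝ) = x₀ * e₂ - 2 * x₀ * ξ * e₁ - e₁ * e₁ := by
    push_cast
    rw [he₁, he₂]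
    ring
  have b₁ : |x₀ * e₂| ≤ x₀ * l := by
    rw [abs_mul, abs_of_pos (by linarith : (0 : ℝ) < x₀)]
    gcongr
  have b₂ : |2 * x₀ * ξ * e₁| ≤ 2 * x₀ * |ξ| * l := by
    rw [abs_mul, abs_mul, abs_of_pos (by linarith : (0 : ℝ) < 2 * x₀)]
    gcongr
  have b₃ : |e₁ * e₁| ≤ x₀ * l := by
    rw [abs_mul]
    exact mul_le_mul (h₁.trans (hl.trans hx')) h₁ (abs_nonneg _) (by linarith)
  rw [heq]
  have t₁ := abs_sub (x₀ * e₂ - 2 * x₀ * ξ * e₁) (e₁ * e₁)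
  have t₂ := abs_sub (x₀ * e₂) (2 * x₀ * ξ * e₁)
  linarith

/-- A sufficiently good approximation on the conic `x₀ x₂ = x₁²` is proportional to any other good
approximation of smaller norm. -/
lemma proportional_of_mul_eq_sq {x₀ x₁ x₂ y₀ y₁ y₂ : ℤ} {l L : ℝ} (hy : 1 ≤ y₀) (hyx : y₀ ≤ x₀)
    (hx : x₀ * x₂ = x₁ ^ 2) (hlL : l ≤ L) (hL : L ≤ 1)
    (hx₁ : |(x₁ : ℝ) - x₀ * ξ| ≤ l)
    (hy₁ : |(y₁ : ℝ) - y₀ * ξ| ≤ L) (hy₂ : |(y₂ : ℝ) - y₀ * ξ ^ 2| ≤ L)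
    (hsmall : (2 + 2 * |ξ|) ^ 2 * x₀ * L ^ 2 < 1) :
    x₀ * y₁ = x₁ * y₀ ∧ x₀ * y₂ = x₂ * y₀ := by
  have hx0 : 0 < x₀ := by omega
  have hy' : (1 : ℝ) ≤ y₀ := by exact_mod_cast hy
  have hyx' : (y₀ : ℝ) ≤ x₀ := by exact_mod_cast hyx
  have hx' : (0 : ℝ) < x₀ := by exact_mod_cast hx0
  have hL0 : 0 ≤ L := (abs_nonneg _).trans hy₁
  have hξ := abs_nonneg ξ
  have vanish : ∀ A D : ℤ, x₀ * A = D ^ 2 → |(D : ℝ)| ≤ (2 + 2 * |ξ|) * x₀ * L → D = 0 := by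
    intro A D hAD hD
    have hA0 : 0 ≤ A := nonneg_of_mul_nonneg_right (hAD ▸ sq_nonneg D) hx0
    have hA1 : (A : ℝ) < 1 := by
      have h1 : (x₀ : ℝ) * A = |(D : ℝ)| ^ 2 := by
        rw [sq_abs]
        exact_mod_cast hAD
      have h2 : |(D : ℝ)| ^ 2 ≤ ((2 + 2 * |ξ|) * x₀ * L) ^ 2 := by gcongr
      have h3 : (x₀ : ℝ) * A ≤ x₀ * ((2 + 2 * |ξ|) ^ 2 * x₀ * L ^ 2) := by
        rw [h1]
        calc _ ≤ _ := h2
          _ = _ := by ring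
      exact (le_of_mul_le_mul_left h3 hx').trans_lt hsmall
    have hA : A = 0 := by
      have : A < 1 := by exact_mod_cast hA1
      omega
    rw [hA, mul_zero] at hAD
    exact pow_eq_zero_iff two_ne_zero |>.1 hAD.symm
  set e := (x₁ : ℝ) - x₀ * ξ with he
  set e₁ := (y₁ : ℝ) - y₀ * ξ with he₁
  set e₂ := (y₂ : ℝ) - y₀ * ξ ^ 2 with he₂
  have b₁ : |x₀ * e₁| ≤ x₀ * L := by
    rw [abs_mul, abs_of_pos hx']
    gcongr
  have b₂ : |x₀ * e₂| ≤ x₀ * L := by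
    rw [abs_mul, abs_of_pos hx']
    gcongr
  have h₁ : x₀ * y₁ - x₁ * y₀ = 0 := by
    refine vanish (x₂ * y₀ ^ 2 - 2 * x₁ * y₀ * y₁ + x₀ * y₁ ^ 2) _
      (by linear_combination y₀ ^ 2 * hx) ?_
    have heq : ((x₀ * y₁ - x₁ * y₀ : ℤ) : ℝ) = x₀ * e₁ - y₀ * e := by
      push_cast
      rw [he, he₁]
      ring
    have b₃ : |y₀ * e| ≤ x₀ * L := by
      rw [abs_mul, abs_of_pos (by linarith : (0 : ℝ) < y₀)]
      exact mul_le_mul hyx' (hx₁.trans hlL) (abs_nonneg _) hx'.le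
    rw [heq]
    have t := abs_sub (x₀ * e₁) (y₀ * e)
    have : 0 ≤ |ξ| * (x₀ * L) := by positivity
    linarith
  have h₂ : x₁ * y₁ - x₀ * y₂ = 0 := by
    refine vanish (x₂ * y₁ ^ 2 - 2 * x₁ * y₁ * y₂ + x₀ * y₂ ^ 2) _
      (by linear_combination y₁ ^ 2 * hx) ?_
    have heq : ((x₁ * y₁ - x₀ * y₂ : ℤ) : ℝ) = x₀ * ξ * e₁ - x₀ * e₂ + e * y₁ := by
      push_cast
      rw [he, he₁, he₂]
      ring
    have b₃ : |x₀ * ξ * e₁| ≤ |ξ| * (x₀ * L) := by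
      rw [mul_assoc, mul_left_comm, abs_mul, abs_mul, abs_of_pos hx']
      gcongr
    have b₄ : |e * y₁| ≤ L * (x₀ * (1 + |ξ|)) := by
      have : |(y₁ : ℝ)| ≤ x₀ * (1 + |ξ|) := by
        have : (y₁ : ℝ) = e₁ + y₀ * ξ := by rw [he₁]; ring
        rw [this]
        refine (abs_add_le _ _).trans ?_
        rw [abs_mul, abs_of_pos (by linarith : (0 : ℝ) < y₀)]
        nlinarith
      rw [abs_mul]
      exact mul_le_mul (hx₁.trans hlL) this (abs_nonneg _) hL0
    rw [heq]
    have t₁ := abs_add_le (x₀ * ξ * e₁ - x₀ * e₂) (e * y₁)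
    have t₂ := abs_sub (x₀ * ξ * e₁) (x₀ * e₂)
    linarith
  have h₁' : x₀ * y₁ = x₁ * y₀ := by linarith
  refine ⟨h₁', mul_left_cancel₀ hx0.ne' ?_⟩
  linear_combination (-x₀) * h₂ + x₁ * h₁' - y₀ * hx

/-- A determinant estimate for three successive approximations. -/
lemma abs_det_le {u v w : Fin 3 → ℤ} {l₀ l₁ l₂ : ℝ}
    (hu0 : 0 ≤ u 0) (huv : u 0 ≤ v 0) (hvw : v 0 ≤ w 0) (h10 : l₁ ≤ l₀) (h21 : l₂ ≤ l₁)
    (hu₁ : |(u 1 : ℝ) - u 0 * ξ| ≤ l₀) (hu₂ : |(u 2 : ℝ) - u 0 * ξ ^ 2| ≤ l₀)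
    (hv₁ : |(v 1 : ℝ) - v 0 * ξ| ≤ l₁) (hv₂ : |(v 2 : ℝ) - v 0 * ξ ^ 2| ≤ l₁)
    (hw₁ : |(w 1 : ℝ) - w 0 * ξ| ≤ l₂) (hw₂ : |(w 2 : ℝ) - w 0 * ξ ^ 2| ≤ l₂) :
    |((crossProduct u v ⬝ᵥ w : ℤ) : ℝ)| ≤ 6 * w 0 * l₀ * l₁ := by
  have hu0' : (0 : ℝ) ≤ u 0 := by exact_mod_cast hu0
  have huv' : (u 0 : ℝ) ≤ v 0 := by exact_mod_cast huv
  have hvw' : (v 0 : ℝ) ≤ w 0 := by exact_mod_cast hvw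
  have term : ∀ z s t l m : ℝ, 0 ≤ z → z ≤ w 0 → |s| ≤ l → |t| ≤ m → l * m ≤ l₀ * l₁ →
      |z * (s * t)| ≤ w 0 * (l₀ * l₁) := by
    intro z s t l m hz hzw hs ht hlm
    rw [abs_mul, abs_mul, abs_of_nonneg hz]
    refine mul_le_mul hzw ((mul_le_mul hs ht (abs_nonneg _) ((abs_nonneg _).trans hs)).trans hlm)
      (by positivity) (by linarith)
  have p0 : 0 ≤ l₀ := (abs_nonneg _).trans hu₁
  have p1 : 0 ≤ l₁ := (abs_nonneg _).trans hv₁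
  have p2 : 0 ≤ l₂ := (abs_nonneg _).trans hw₁
  have q12 : l₁ * l₂ ≤ l₀ * l₁ := by nlinarith
  have q02 : l₀ * l₂ ≤ l₀ * l₁ := by nlinarith
  have t₁ := term _ _ _ _ _ hu0' (huv'.trans hvw') hv₁ hw₂ q12
  have t₂ := term _ _ _ _ _ hu0' (huv'.trans hvw') hv₂ hw₁ q12
  have t₃ := term _ _ _ _ _ (hu0'.trans huv') hvw' hu₁ hw₂ q02
  have t₄ := term _ _ _ _ _ (hu0'.trans huv') hvw' hu₂ hw₁ q02
  have t₅ := term _ _ _ _ _ (hu0'.trans (huv'.trans hvw')) le_rfl hu₁ hv₂ le_rfl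
  have t₆ := term _ _ _ _ _ (hu0'.trans (huv'.trans hvw')) le_rfl hu₂ hv₁ le_rfl
  have heq : ((crossProduct u v ⬝ᵥ w : ℤ) : ℝ) =
      u 0 * (((v 1 : ℝ) - v 0 * ξ) * ((w 2 : ℝ) - w 0 * ξ ^ 2))
      - u 0 * (((v 2 : ℝ) - v 0 * ξ ^ 2) * ((w 1 : ℝ) - w 0 * ξ))
      - v 0 * (((u 1 : ℝ) - u 0 * ξ) * ((w 2 : ℝ) - w 0 * ξ ^ 2))
      + v 0 * (((u 2 : ℝ) - u 0 * ξ ^ 2) * ((w 1 : ℝ) - w 0 * ξ))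
      + w 0 * (((u 1 : ℝ) - u 0 * ξ) * ((v 2 : ℝ) - v 0 * ξ ^ 2))
      - w 0 * (((u 2 : ℝ) - u 0 * ξ ^ 2) * ((v 1 : ℝ) - v 0 * ξ)) := by
    simp only [cross_apply, dotProduct, Fin.sum_univ_three, Matrix.cons_val_zero,
      Matrix.cons_val_one, Matrix.cons_val]
    push_cast
    ring
  rw [heq, abs_le]
  rw [abs_le] at t₁ t₂ t₃ t₄ t₅ t₆
  constructor <;> linarith

/-- If `z` is orthogonal to two vectors with nonzero cross product, it is orthogonal to every vector
coplanar with them. -/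
lemma dotProduct_eq_zero_of_coplanar {u v w z : Fin 3 → ℤ} (huv : crossProduct u v ≠ 0)
    (hu : z ⬝ᵥ u = 0) (hv : z ⬝ᵥ v = 0) (hdet : crossProduct u v ⬝ᵥ w = 0) : z ⬝ᵥ w = 0 := by
  obtain ⟨b, hb⟩ := Function.ne_iff.1 huv
  refine (mul_eq_zero.1 ?_).resolve_left hb
  simp only [cross_apply, dotProduct, Fin.sum_univ_three, Matrix.cons_val_zero,
      Matrix.cons_val_one, Matrix.cons_val] at *
  fin_cases b <;> simp only [Fin.zero_eta, Fin.mk_one, Fin.reduceFinMk, Matrix.cons_val_zero,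
      Matrix.cons_val_one, Matrix.cons_val]
  · linear_combination z 0 * hdet + (w 1 * v 2 - w 2 * v 1) * hu - (w 1 * u 2 - w 2 * u 1) * hv
  · linear_combination z 1 * hdet + (w 2 * v 0 - w 0 * v 2) * hu - (w 2 * u 0 - w 0 * u 2) * hv
  · linear_combination z 2 * hdet + (w 0 * v 1 - w 1 * v 0) * hu - (w 0 * u 1 - w 1 * u 0) * hv

/-- The exponent `1/γ` satisfies `θ² = 1 - θ`; the two growth conditions are incompatible. -/
lemma golden_exponent_incompatible {θ d K a b : ℝ} (hθ0 : 0 < θ) (hθ : θ ^ 2 = 1 - θ)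
    (hd : 0 < d) (hK : 2 ≤ K) (hKd : K * d ≤ 1 / 3) (ha : 0 < a) (hb : 0 < b)
    (h₁ : 1 ≤ 6 * b * (d * a ^ (-θ)) * (d * b ^ (-θ)))
    (h₂ : 1 ≤ K * a * (d * b ^ (-θ))) : False := by
  have ha' : 0 < a ^ θ := Real.rpow_pos_of_pos ha θ
  have hb' : 0 < b ^ θ := Real.rpow_pos_of_pos hb θ
  rw [Real.rpow_neg hb.le] at h₁ h₂
  rw [Real.rpow_neg ha.le] at h₁
  have h₂' : b ^ θ ≤ K * d * a := by
    have := mul_le_mul_of_nonneg_right h₂ hb'.le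
    have e : K * a * (d * (b ^ θ)⁻¹) * b ^ θ = K * d * a := by field_simp
    linarith
  have hbb : b = b ^ θ * (b ^ θ) ^ θ := by
    rw [← Real.rpow_mul hb.le, ← Real.rpow_add hb]
    have : θ + θ * θ = 1 := by linarith [sq θ]
    rw [this, Real.rpow_one]
  have h₁' : a ^ θ ≤ 6 * d ^ 2 * (b ^ θ) ^ θ := by
    have := mul_le_mul_of_nonneg_right h₁ ha'.le
    have e : 6 * b * (d * (a ^ θ)⁻¹) * (d * (b ^ θ)⁻¹) * a ^ θ = 6 * d ^ 2 * (b * (b ^ θ)⁻¹) := by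
      field_simp
    have e' : b * (b ^ θ)⁻¹ = (b ^ θ) ^ θ := by
      nth_rewrite 1 [hbb]
      field_simp
    rw [e, e'] at this
    linarith
  have h₃ : (b ^ θ) ^ θ ≤ a ^ θ := by
    refine Real.rpow_le_rpow hb'.le (h₂'.trans ?_) hθ0.le
    nlinarith
  have hd' : d ≤ 1 / 6 := by nlinarith
  have h₄ : 6 * d ^ 2 * (b ^ θ) ^ θ ≤ 6 * (1 / 6) ^ 2 * a ^ θ := by gcongr
  linarith

/-- Davenport and Schmidt: `ξ` and `ξ²` are not uniformly simultaneously approximable with exponent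
`1/γ` and a small constant. -/
theorem exists_lower_bound_distNearestInt {θ : ℝ} (hθ2 : 1 / 2 ≤ θ) (hθ : θ ^ 2 = 1 - θ)
    (hξ : ∀ a b c : ℤ, (a : ℝ) + b * ξ + c * ξ ^ 2 = 0 → a = 0 ∧ b = 0 ∧ c = 0) :
    ∃ c : ℝ, 0 < c ∧ ∀ N₀ : ℕ, ∃ N : ℕ, N₀ ≤ N ∧ 1 ≤ N ∧
      ∀ n : ℕ, 1 ≤ n → n ≤ N → c * (N : ℝ) ^ (-θ) ≤ distNearestInt ξ n := by
  set K := 2 + 2 * |ξ| with hK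
  have hK2 : 2 ≤ K := by
    have := abs_nonneg ξ
    linarith
  set d := 1 / (3 * K) with hd
  have hd0 : 0 < d := by positivity
  have hKd : K * d = 1 / 3 := by rw [hd]; field_simp
  have hθ1 : θ ≤ 1 := by nlinarith
  refine ⟨d / 2, by positivity, ?_⟩
  by_contra! hcon
  obtain ⟨N₀, hN₀⟩ := hcon
  set f := distNearestInt ξ with hf
  have hf₁ : ∀ n : ℕ, |(round (n * ξ) : ℝ) - n * ξ| ≤ f n := fun n => le_max_left _ _
  have hf₂ : ∀ n : ℕ, |(round (n * ξ ^ 2) : ℝ) - n * ξ ^ 2| ≤ f n := fun n => le_max_right _ _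
  have hf1 : ∀ n, f n ≤ 1 := fun n => by
    refine max_le ?_ ?_
    all_goals
      rw [abs_sub_comm]
      refine (abs_sub_round _).trans (by norm_num)
  have hpos : ∀ n, 1 ≤ n → 0 < f n := by
    intro n hn
    refine lt_of_lt_of_le (abs_pos.2 fun h => ?_) (hf₁ n)
    have := (hξ (round (n * ξ)) (-n) 0 (by push_cast; linarith)).2.1
    omega
  have hsmall : ∀ ε, 0 < ε → ∃ n, 1 ≤ n ∧ f n < ε := by
    intro ε hε
    have hlim : Filter.Tendsto (fun N : ℕ => d / 2 * (N : ℝ) ^ (-θ)) Filter.atTop (nhds 0) := by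
      have := ((tendsto_rpow_neg_atTop (show 0 < θ by linarith)).comp
        tendsto_natCast_atTop_atTop).const_mul (d / 2)
      simpa using this
    obtain ⟨N, hN, hN'⟩ := ((hlim.eventually_lt_const hε).and
      (Filter.eventually_ge_atTop (N₀ + 1))).exists
    obtain ⟨n, hn1, -, hn⟩ := hN₀ N (by omega) (by omega)
    exact ⟨n, hn1, hn.trans hN⟩
  obtain ⟨q, hqm, hq1, hqf, hqmin⟩ := exists_record_sequence hpos hsmall
  have hL : ∀ i, N₀ + 1 ≤ i → f (q i) ≤ d * (q (i + 1) : ℝ) ^ (-θ) := by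
    intro i hi
    have hqi : i + 1 ≤ q (i + 1) := hqm.le_apply
    obtain ⟨n, hn1, hn, hfn⟩ := hN₀ (q (i + 1) - 1) (by omega) (by omega)
    have h2 : (q (i + 1) : ℝ) / 2 ≤ ((q (i + 1) - 1 : ℕ) : ℝ) := by
      rw [Nat.cast_sub (hq1 _)]
      have : (2 : ℝ) ≤ q (i + 1) := by
        exact_mod_cast (by omega : 2 ≤ q (i + 1))
      push_cast
      linarith
    have hq0 : (0 : ℝ) < q (i + 1) := by exact_mod_cast hq1 (i + 1)
    have h3 : ((q (i + 1) - 1 : ℕ) : ℝ) ^ (-θ) ≤ 2 * (q (i + 1) : ℝ) ^ (-θ) := by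
      refine (Real.rpow_le_rpow_of_nonpos (by positivity) h2 (by linarith)).trans ?_
      rw [Real.div_rpow hq0.le two_pos.le, Real.rpow_neg two_pos.le, div_inv_eq_mul, mul_comm]
      gcongr
      simpa using Real.rpow_le_rpow_of_exponent_le one_le_two hθ1
    calc f (q i) ≤ f n := hqmin i n hn1 (by omega)
      _ ≤ d / 2 * ((q (i + 1) - 1 : ℕ) : ℝ) ^ (-θ) := hfn.le
      _ ≤ d / 2 * (2 * (q (i + 1) : ℝ) ^ (-θ)) := by gcongr
      _ = _ := by ring
  let p : ℕ → Fin 3 → ℤ := fun i => ![q i, round (q i * ξ), round (q i * ξ ^ 2)]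
  have hp0 : ∀ i, p i 0 = q i := fun i => rfl
  have hp₁ : ∀ i, |(p i 1 : ℝ) - p i 0 * ξ| ≤ f (q i) := fun i => by
    simpa [p] using hf₁ (q i)
  have hp₂ : ∀ i, |(p i 2 : ℝ) - p i 0 * ξ ^ 2| ≤ f (q i) := fun i => by
    simpa [p] using hf₂ (q i)
  have hpf : ∀ i, f (q i) = max |(p i 1 : ℝ) - p i 0 * ξ| |(p i 2 : ℝ) - p i 0 * ξ ^ 2| :=
    fun i => by simp [p, hf, distNearestInt]
  have hcross : ∀ i, crossProduct (p i) (p (i + 1)) ≠ 0 := by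
    intro i h
    have hx0 : (0 : ℝ) < q (i + 1) := by exact_mod_cast hq1 (i + 1)
    have hy0 : (0 : ℝ) < q i := by exact_mod_cast hq1 i
    have hlt : (q i : ℝ) < q (i + 1) := by exact_mod_cast hqm (Nat.lt_succ_self i)
    have c₁ := congrFun h 1
    have c₂ := congrFun h 2
    simp only [cross_apply, Matrix.cons_val_zero, Matrix.cons_val_one, Matrix.cons_val,
      Pi.zero_apply] at c₁ c₂
    rw [hp0, hp0] at c₁ c₂
    have c₁' : (p i 2 : ℝ) * q (i + 1) - q i * p (i + 1) 2 = 0 := by exact_mod_cast c₁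
    have c₂' : (q i : ℝ) * p (i + 1) 1 - p i 1 * q (i + 1) = 0 := by exact_mod_cast c₂
    have bound : ∀ e e' : ℝ, q (i + 1) * e = q i * e' → |e'| ≤ f (q (i + 1)) →
        |e| ≤ q i * f (q (i + 1)) / q (i + 1) := by
      intro e e' he he'
      rw [le_div_iff₀ hx0]
      have := congrArg abs he
      rw [abs_mul, abs_mul, abs_of_pos hx0, abs_of_pos hy0] at this
      rw [mul_comm, this]
      gcongr
    have hle : f (q i) ≤ q i * f (q (i + 1)) / q (i + 1) := by
      rw [hpf i]
      refine max_le (bound _ _ ?_ (hp₁ _)) (bound _ _ ?_ (hp₂ _))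
      · rw [hp0, hp0]
        push_cast
        linear_combination -c₂'
      · rw [hp0, hp0]
        push_cast
        linear_combination c₁'
    rw [le_div_iff₀ hx0] at hle
    have := hqf i
    have := hpos _ (hq1 i)
    nlinarith
  obtain ⟨i, hi, hdet⟩ : ∃ i, N₀ + 1 ≤ i ∧
      crossProduct (p i) (p (i + 1)) ⬝ᵥ p (i + 2) ≠ 0 := by
    by_contra! h
    set i₀ := N₀ + 1
    set z := crossProduct (p i₀) (p (i₀ + 1)) with hz
    have horth : ∀ j, z ⬝ᵥ p (i₀ + j) = 0 ∧ z ⬝ᵥ p (i₀ + j + 1) = 0 := by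
      intro j
      induction j with
      | zero =>
        constructor
        · rw [dotProduct_comm]
          exact dot_self_cross _ _
        · rw [dotProduct_comm]
          exact dot_cross_self _ _
      | succ j ih =>
        exact ⟨ih.2, dotProduct_eq_zero_of_coplanar (hcross _) ih.1 ih.2 (h _ (by omega))⟩
    have hbound : ∀ j : ℕ, (j : ℝ) * |(z 0 : ℝ) + z 1 * ξ + z 2 * ξ ^ 2| ≤
        |(z 1 : ℝ)| + |(z 2 : ℝ)| := by
      intro j
      have hj := (horth j).1
      simp only [dotProduct, Fin.sum_univ_three] at hj
      have hj' : (z 0 : ℝ) * p (i₀ + j) 0 + z 1 * p (i₀ + j) 1 + z 2 * p (i₀ + j) 2 = 0 := by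
        exact_mod_cast hj
      have hjq : (j : ℝ) ≤ p (i₀ + j) 0 := by
        rw [hp0]
        have : i₀ + j ≤ q (i₀ + j) := hqm.le_apply
        exact_mod_cast (by omega : j ≤ q (i₀ + j))
      have h₁ := (hp₁ (i₀ + j)).trans (hf1 _)
      have h₂ := (hp₂ (i₀ + j)).trans (hf1 _)
      calc (j : ℝ) * |(z 0 : ℝ) + z 1 * ξ + z 2 * ξ ^ 2|
          ≤ p (i₀ + j) 0 * |(z 0 : ℝ) + z 1 * ξ + z 2 * ξ ^ 2| := by gcongr
        _ = |p (i₀ + j) 0 * ((z 0 : ℝ) + z 1 * ξ + z 2 * ξ ^ 2)| := by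
          rw [abs_mul, abs_of_nonneg ((Nat.cast_nonneg j).trans hjq)]
        _ = |z 1 * ((p (i₀ + j) 1 : ℝ) - p (i₀ + j) 0 * ξ) +
              z 2 * ((p (i₀ + j) 2 : ℝ) - p (i₀ + j) 0 * ξ ^ 2)| := by
          rw [← abs_neg]
          congr 1
          linear_combination -hj'
        _ ≤ |(z 1 : ℝ)| * 1 + |(z 2 : ℝ)| * 1 := by
          refine (abs_add_le _ _).trans ?_
          rw [abs_mul, abs_mul]
          gcongr
        _ = _ := by ring
    have hzero : (z 0 : ℝ) + z 1 * ξ + z 2 * ξ ^ 2 = 0 := by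
      by_contra hne
      obtain ⟨j, hj⟩ := exists_nat_gt
        ((|(z 1 : ℝ)| + |(z 2 : ℝ)|) / |(z 0 : ℝ) + z 1 * ξ + z 2 * ξ ^ 2|)
      rw [div_lt_iff₀ (abs_pos.2 hne)] at hj
      exact absurd (hbound j) (not_le.2 hj)
    obtain ⟨h0, h1, h2⟩ := hξ _ _ _ hzero
    refine hcross i₀ (funext fun k => ?_)
    rw [← hz]
    fin_cases k <;> assumption
  have hqlt : ∀ j, (p j 0) ≤ p (j + 1) 0 := fun j => by
    rw [hp0, hp0]
    exact_mod_cast (hqm (Nat.lt_succ_self j)).le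
  have hp1 : ∀ j, 1 ≤ p j 0 := fun j => by
    rw [hp0]
    exact_mod_cast hq1 j
  have ha1 : (1 : ℝ) ≤ q (i + 1) := by exact_mod_cast hq1 (i + 1)
  have hb1 : (1 : ℝ) ≤ q (i + 2) := by exact_mod_cast hq1 (i + 2)
  have hl₀ := hL i hi
  have hl₁ := hL (i + 1) (by omega)
  have one_le_abs : ∀ m : ℤ, m ≠ 0 → (1 : ℝ) ≤ |(m : ℝ)| := fun m hm => by
    exact_mod_cast Int.one_le_abs hm
  have hf0 : ∀ j, 0 ≤ f (q j) := fun j => (hpos _ (hq1 j)).le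
  refine golden_exponent_incompatible (a := q (i + 1)) (b := q (i + 2)) (θ := θ) (d := d) (K := K)
    (by linarith) hθ hd0 hK2 hKd.le (by linarith) (by linarith) ?_ ?_
  · refine (one_le_abs _ hdet).trans ((abs_det_le (by linarith [hp1 i]) (hqlt i) (hqlt (i + 1))
      (hqf i).le (hqf (i + 1)).le (hp₁ i) (hp₂ i) (hp₁ _) (hp₂ _) (hp₁ _) (hp₂ _)).trans ?_)
    rw [hp0, Int.cast_natCast]
    have := hf0 i
    have := hf0 (i + 1)
    gcongr
  · have hne : p (i + 1) 0 * p (i + 1) 2 - p (i + 1) 1 ^ 2 ≠ 0 := by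
      intro h
      obtain ⟨e₁, e₂⟩ := proportional_of_mul_eq_sq (hp1 i) (hqlt i) (sub_eq_zero.1 h) (hqf i).le
        (hf1 _) (hp₁ _) (hp₁ _) (hp₂ _) (by
          rw [hp0, Int.cast_natCast, ← hK]
          have hsq : f (q i) ^ 2 ≤ (d * (q (i + 1) : ℝ) ^ (-θ)) ^ 2 := by
            have := hf0 i
            gcongr
          have hpow : (q (i + 1) : ℝ) * ((q (i + 1) : ℝ) ^ (-θ)) ^ 2 ≤ 1 := by
            have h0 : (0 : ℝ) < q (i + 1) := by linarith
            rw [← Real.rpow_mul_natCast h0.le]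
            nth_rewrite 1 [← Real.rpow_one (q (i + 1) : ℝ)]
            rw [← Real.rpow_add h0]
            refine Real.rpow_le_one_of_one_le_of_nonpos ha1 ?_
            push_cast
            linarith
          calc K ^ 2 * q (i + 1) * f (q i) ^ 2
              ≤ K ^ 2 * q (i + 1) * (d * (q (i + 1) : ℝ) ^ (-θ)) ^ 2 := by gcongr
            _ = (K * d) ^ 2 * (q (i + 1) * ((q (i + 1) : ℝ) ^ (-θ)) ^ 2) := by ring
            _ ≤ (K * d) ^ 2 * 1 := by gcongr
            _ < 1 := by rw [hKd]; norm_num)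
      refine hcross i ?_
      have hx0 : p (i + 1) 0 ≠ 0 := by linarith [hp1 (i + 1)]
      have e₃ : p i 1 * p (i + 1) 2 - p i 2 * p (i + 1) 1 = 0 := by
        refine (mul_eq_zero.1 ?_).resolve_left hx0
        linear_combination p (i + 1) 2 * e₁ - p (i + 1) 1 * e₂
      ext k
      fin_cases k <;> simp only [cross_apply, Fin.zero_eta, Fin.mk_one, Fin.reduceFinMk,
        Matrix.cons_val_zero, Matrix.cons_val_one, Matrix.cons_val, Pi.zero_apply]
      · exact e₃
      · linear_combination e₂
      · linear_combination -e₁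
    refine (one_le_abs _ hne).trans ((abs_mul_sub_mul_sq_le (hp1 _) (hf1 _) (hp₁ _)
      (hp₂ _)).trans ?_)
    rw [hp0, Int.cast_natCast, ← hK]
    gcongr

end SimultaneousApproximation

section MonicCubic

open Polynomial

/-- Real quadratic polynomials, measured by their value at `ξ` and by their two leading
coefficients, are close to integer ones as soon as `ξ` and `ξ²` admit no good simultaneous
approximation. -/
lemma exists_int_quadratic_near {c : ℝ} (hc : 0 < c) :
    ∃ C : ℝ, 0 < C ∧ ∀ ξ X Y : ℝ, 1 ≤ X → 1 ≤ Y →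
      (∀ x₀ x₁ x₂ : ℤ, x₀ ≠ 0 → |(x₀ : ℝ)| ≤ X →
        c ≤ Y * |(x₁ : ℝ) - x₀ * ξ| ∨ c ≤ Y * |(x₂ : ℝ) - x₀ * ξ ^ 2|) →
      ∀ t₀ t₁ t₂ : ℝ, ∃ p₀ p₁ p₂ : ℤ, |t₀ - X * (p₀ + p₁ * ξ + p₂ * ξ ^ 2)| ≤ C ∧
        |t₁ - p₁ / Y| ≤ C ∧ |t₂ - p₂ / Y| ≤ C := by
  obtain ⟨C, hC, hcov⟩ := exists_covering_radius (lt_min one_pos hc) 3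
  refine ⟨C, hC, fun ξ X Y hX hY happrox t₀ t₁ t₂ => ?_⟩
  have hX0 : 0 < X := by linarith
  have hY0 : 0 < Y := by linarith
  let φ : (Fin 3 → ℤ) →+ EuclideanSpace ℝ (Fin 3) := AddMonoidHom.mk'
    (fun p => !₂[X * (p 0 + p 1 * ξ + p 2 * ξ ^ 2), p 1 / Y, p 2 / Y]) (by
      intro p p'
      ext i
      fin_cases i <;> simp <;> ring)
  have hφ : ∀ p, φ p = !₂[X * (p 0 + p 1 * ξ + p 2 * ξ ^ 2), p 1 / Y, p 2 / Y] := fun p => rfl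
  have hcoord : ∀ (y : EuclideanSpace ℝ (Fin 3)) i, |y i| ≤ ‖y‖ := fun y i =>
    PiLp.norm_apply_le y i
  obtain ⟨_, ⟨p, rfl⟩, hp⟩ := hcov (EuclideanSpace ℝ (Fin 3)) (by simp) φ.range (by
    intro y hy0 hy
    have hy' : ∀ p : Fin 3 → ℤ, ∃ k : ℤ,
        X * (p 0 + p 1 * ξ + p 2 * ξ ^ 2) * y 0 + p 1 / Y * y 1 + p 2 / Y * y 2 = k := by
      intro p
      obtain ⟨k, hk⟩ := hy (φ p) ⟨p, rfl⟩
      refine ⟨k, ?_⟩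
      rw [← hk, hφ]
      simp [PiLp.inner_apply, Fin.sum_univ_three]
      ring
    obtain ⟨x₀, h₀⟩ := hy' ![1, 0, 0]
    obtain ⟨x₁, h₁⟩ := hy' ![0, 1, 0]
    obtain ⟨x₂, h₂⟩ := hy' ![0, 0, 1]
    simp at h₀ h₁ h₂
    have e₁ : y 1 = Y * (x₁ - x₀ * ξ) := by
      rw [← h₁, ← h₀]
      field_simp
      ring
    have e₂ : y 2 = Y * (x₂ - x₀ * ξ ^ 2) := by
      rw [← h₂, ← h₀]
      field_simp
      ring
    have one_le_abs : ∀ m : ℤ, m ≠ 0 → (1 : ℝ) ≤ |(m : ℝ)| := fun m hm => by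
      exact_mod_cast Int.one_le_abs hm
    by_cases hx₀ : x₀ = 0
    · refine (min_le_left _ _).trans ?_
      rw [hx₀, Int.cast_zero] at h₀ e₁ e₂
      have large : ∀ m : ℤ, m ≠ 0 → 1 ≤ |Y * (m - 0 * ξ)| ∧ 1 ≤ |Y * (m - 0 * ξ ^ 2)| := by
        intro m hm
        rw [zero_mul, zero_mul, sub_zero, abs_mul, abs_of_pos hY0]
        have := one_le_abs m hm
        constructor <;> nlinarith
      by_cases hx₁ : x₁ = 0
      · by_cases hx₂ : x₂ = 0
        · exfalso
          apply hy0
          ext i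
          fin_cases i
          · simpa [hX0.ne'] using h₀
          · simpa [hx₁] using e₁
          · simpa [hx₂] using e₂
        · exact ((large x₂ hx₂).2.trans_eq (congrArg abs e₂.symm)).trans (hcoord y 2)
      · exact ((large x₁ hx₁).1.trans_eq (congrArg abs e₁.symm)).trans (hcoord y 1)
    · by_cases hle : |(x₀ : ℝ)| ≤ X
      · refine (min_le_right _ _).trans ?_
        rcases happrox x₀ x₁ x₂ hx₀ hle with h | h
        · refine le_trans ?_ (hcoord y 1)
          rwa [e₁, abs_mul, abs_of_pos hY0]
        · refine le_trans ?_ (hcoord y 2)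
          rwa [e₂, abs_mul, abs_of_pos hY0]
      · refine (min_le_left _ _).trans (le_trans ?_ (hcoord y 0))
        rw [← h₀, abs_mul, abs_of_pos hX0] at hle
        nlinarith [abs_nonneg (y 0)]) !₂[t₀, t₁, t₂]
  refine ⟨p 0, p 1, p 2, ?_, ?_, ?_⟩
  · simpa [hφ] using (hcoord _ 0).trans hp
  · simpa [hφ] using (hcoord _ 1).trans hp
  · simpa [hφ] using (hcoord _ 2).trans hp

lemma int_quadratic_eq_zero {ξ : ℝ}
    (hξ : ¬ ∃ Q : ℚ[X], Q ≠ 0 ∧ Q.natDegree ≤ 2 ∧ aeval ξ Q = 0) (a b c : ℤ)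
    (h : (a : ℝ) + b * ξ + c * ξ ^ 2 = 0) : a = 0 ∧ b = 0 ∧ c = 0 := by
  by_contra hne
  refine hξ ⟨C (c : ℚ) * X ^ 2 + C (b : ℚ) * X + C (a : ℚ), fun h0 => hne ?_,
    natDegree_quadratic_le, ?_⟩
  · have h₀ := congrArg (coeff · 0) h0
    have h₁ := congrArg (coeff · 1) h0
    have h₂ := congrArg (coeff · 2) h0
    simp only [coeff_add, coeff_C_mul, coeff_X_pow, coeff_X, coeff_C, coeff_zero] at h₀ h₁ h₂
    norm_num at h₀ h₁ h₂
    exact ⟨h₀, h₁, h₂⟩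
  · simp only [map_add, map_mul, map_pow, aeval_X, map_intCast]
    linarith

lemma isMinIntPoly_minpoly {α : ℝ} (hα : IsIntegral ℤ α) : IsMinIntPoly α (minpoly ℤ α) := by
  have hmonic := minpoly.monic hα
  refine ⟨hmonic.ne_zero, by rw [hmonic.leadingCoeff]; exact one_pos, hmonic.isPrimitive.content_eq_one,
    minpoly.aeval ℤ α, fun Q hQ hQα => ?_⟩
  exact natDegree_le_natDegree (minpoly.IsIntegrallyClosed.degree_le_of_ne_zero hQ hQα)

lemma one_le_intPolyHeight {P : ℤ[X]} (hP : P.Monic) : 1 ≤ intPolyHeight P := by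
  have h : (P.coeff P.natDegree).natAbs ≤ intPolyHeight P :=
    Finset.le_sup (f := fun i => (P.coeff i).natAbs) (by simp)
  simpa [hP.coeff_natDegree] using h

/-- A Gelfond-type inequality for monic divisors of monic cubic polynomials. -/
lemma intPolyHeight_le_of_dvd_cubic {P : ℤ[X]} (hP : P.Monic) {p₀ p₁ p₂ : ℤ}
    (hdvd : P ∣ (⟨1, p₂, p₁, p₀⟩ : Cubic ℤ).toPoly) :
    (intPolyHeight P : ℝ) ≤ 3 * (1 + |(p₂ : ℝ)| + |(p₁ : ℝ)| + |(p₀ : ℝ)|) := by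
  set Q := (⟨1, p₂, p₁, p₀⟩ : Cubic ℤ).toPoly with hQ
  have hQm : Q.Monic := Cubic.monic_of_a_eq_one rfl
  have hQd : Q.natDegree = 3 := Cubic.natDegree_of_a_ne_zero one_ne_zero
  obtain ⟨R, hR⟩ := hdvd
  have hRm : R.Monic := hP.of_mul_monic_left (hR ▸ hQm)
  have hv : Isometry (Int.castRingHom ℂ) :=
    AddMonoidHomClass.isometry_of_norm _ fun n => by simp [Int.norm_eq_abs]
  have hd : P.natDegree ≤ 3 := by
    rw [← hQd, hR]
    exact natDegree_le_of_dvd (dvd_mul_right _ _) (hR ▸ hQm.ne_zero)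
  have hM : P.mapMahlerMeasure (Int.castRingHom ℂ) ≤
      1 + |(p₂ : ℝ)| + |(p₁ : ℝ)| + |(p₀ : ℝ)| := by
    calc P.mapMahlerMeasure (Int.castRingHom ℂ)
        ≤ P.mapMahlerMeasure (Int.castRingHom ℂ) * R.mapMahlerMeasure (Int.castRingHom ℂ) :=
          le_mul_of_one_le_right (mapMahlerMeasure_nonneg _ _) (hRm.one_le_mapMahlerMeasure _ hv)
      _ = Q.mapMahlerMeasure (Int.castRingHom ℂ) := by rw [hR, mapMahlerMeasure_mul]
      _ ≤ Q.sum fun _ a => ‖a‖ := mapMahlerMeasure_le_sum_norm_coeff _ _ hv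
      _ = _ := by
        rw [sum_over_range _ (fun _ => norm_zero), hQd]
        simp only [Finset.sum_range_succ, Finset.sum_range_zero, hQ, Cubic.coeff_eq_a,
          Cubic.coeff_eq_b, Cubic.coeff_eq_c, Cubic.coeff_eq_d, Int.norm_eq_abs]
        push_cast
        rw [abs_one]
        ring
  have hcoeff : ∀ i ∈ Finset.range (P.natDegree + 1),
      ((P.coeff i).natAbs : ℝ) ≤ 3 * (1 + |(p₂ : ℝ)| + |(p₁ : ℝ)| + |(p₀ : ℝ)|) := by
    intro i hi
    have hchoose : P.natDegree.choose i ≤ 3 := by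
      have hi' := Finset.mem_range.1 hi
      generalize P.natDegree = m at hd hi'
      interval_cases m <;> interval_cases i <;> decide
    have h := norm_coeff_le_choose_mul_mapMahlerMeasure (Int.castRingHom ℂ) hv i P
    rw [Int.norm_eq_abs] at h
    rw [Nat.cast_natAbs, Int.cast_abs]
    refine h.trans ?_
    have : ((P.natDegree.choose i : ℕ) : ℝ) ≤ 3 := by exact_mod_cast hchoose
    exact mul_le_mul this hM (mapMahlerMeasure_nonneg _ _) (by norm_num)
  obtain ⟨i, hi, hmax⟩ := Finset.exists_mem_eq_sup (Finset.range (P.natDegree + 1)) (by simp)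
    fun i => (P.coeff i).natAbs
  rw [intPolyHeight, hmax]
  exact hcoeff i hi

/-- A monic cubic polynomial which is small at `ξ` and has large slope there has a root near
`ξ`. -/
lemma exists_cubic_root_near {ξ p₀ p₁ p₂ Y δ : ℝ} (hδ : 0 ≤ δ) (hδ1 : δ ≤ 1)
    (hslope : Y ≤ p₁ - |p₂| * (2 * |ξ| + 1)) (h0 : 0 ≤ ξ ^ 3 + p₂ * ξ ^ 2 + p₁ * ξ + p₀)
    (h1 : ξ ^ 3 + p₂ * ξ ^ 2 + p₁ * ξ + p₀ ≤ δ * Y) :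
    ∃ α, |ξ - α| ≤ δ ∧ α ^ 3 + p₂ * α ^ 2 + p₁ * α + p₀ = 0 := by
  let g : ℝ → ℝ := fun s => s ^ 3 + p₂ * s ^ 2 + p₁ * s + p₀
  have hleft : g (ξ - δ) ≤ 0 := by
    have hfactor : g ξ - g (ξ - δ) =
        δ * (ξ ^ 2 + ξ * (ξ - δ) + (ξ - δ) ^ 2 + p₂ * (2 * ξ - δ) + p₁) := by
      simp only [g]
      ring
    have hquad : 0 ≤ ξ ^ 2 + ξ * (ξ - δ) + (ξ - δ) ^ 2 := by
      nlinarith [sq_nonneg (ξ + (ξ - δ)), sq_nonneg ξ, sq_nonneg (ξ - δ)]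
    have hlin : -(|p₂| * (2 * |ξ| + 1)) ≤ p₂ * (2 * ξ - δ) := by
      refine (neg_le_neg ?_).trans (neg_abs_le _)
      rw [abs_mul]
      gcongr
      refine (abs_sub _ _).trans ?_
      rw [abs_mul, abs_two, abs_of_nonneg hδ]
      gcongr
    have : δ * Y ≤ g ξ - g (ξ - δ) := by
      rw [hfactor]
      gcongr
      linarith
    have : g ξ ≤ δ * Y := h1
    linarith
  obtain ⟨α, hα, hgα⟩ := intermediate_value_Icc (show ξ - δ ≤ ξ by linarith)
    (f := g) (by fun_prop) ⟨hleft, h0⟩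
  refine ⟨α, ?_, hgα⟩
  rw [abs_of_nonneg (by linarith [hα.2])]
  linarith [hα.1]

/-- The passage from non-approximability of `ξ` and `ξ²` to approximation of `ξ` by cubic algebraic
integers. -/
lemma exists_cubic_integer_near (ξ : ℝ) {c : ℝ} (hc : 0 < c) :
    ∃ B D : ℝ, 0 < B ∧ 0 < D ∧ ∀ N Y : ℝ, 1 ≤ N → B ≤ N → 1 ≤ Y →
      (∀ x₀ x₁ x₂ : ℤ, x₀ ≠ 0 → |(x₀ : ℝ)| ≤ N →
        c ≤ Y * |(x₁ : ℝ) - x₀ * ξ| ∨ c ≤ Y * |(x₂ : ℝ) - x₀ * ξ ^ 2|) →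
      ∃ (α : ℝ) (P : ℤ[X]), IsMinIntPoly α P ∧ P.Monic ∧ P.natDegree ≤ 3 ∧ 0 < |ξ - α| ∧
        |ξ - α| ≤ B / (N * Y) ∧ (intPolyHeight P : ℝ) ≤ D * Y := by
  obtain ⟨C, hC, hnear⟩ := exists_int_quadratic_near hc
  set M := C + 1 + C * (2 * |ξ| + 1) with hM
  set D := 3 * (1 + C + (M + C) + (3 * C + |ξ| ^ 3 + C * |ξ| ^ 2 + (M + C) * |ξ|)) with hD
  have hM0 : 0 < M := by positivity
  have hD0 : 0 < D := by positivity
  refine ⟨3 * C, D, by positivity, hD0, fun N Y hN1 hNC hY1 happrox => ?_⟩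
  have hN0 : 0 < N := by linarith
  have hY0 : 0 < Y := by linarith
  obtain ⟨p₀, p₁, p₂, hp₀, hp₁, hp₂⟩ := hnear ξ N Y hN1 hY1 happrox (2 * C - N * ξ ^ 3) M 0
  have hp₂' : |(p₂ : ℝ)| ≤ C * Y := by
    rwa [zero_sub, abs_neg, abs_div, abs_of_pos hY0, div_le_iff₀ hY0] at hp₂
  have hp₁l : (M - C) * Y ≤ p₁ := by
    rw [← le_div_iff₀ hY0]
    linarith [(abs_le.1 hp₁).2]
  have hp₁u : (p₁ : ℝ) ≤ (M + C) * Y := by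
    rw [← div_le_iff₀ hY0]
    linarith [(abs_le.1 hp₁).1]
  have hp₁' : |(p₁ : ℝ)| ≤ (M + C) * Y := by
    rw [abs_of_nonneg (le_trans (mul_nonneg ?_ hY0.le) hp₁l)]
    · exact hp₁u
    · have : 0 ≤ C * (2 * |ξ| + 1) := by positivity
      linarith
  set G := ξ ^ 3 + p₂ * ξ ^ 2 + p₁ * ξ + p₀ with hG
  have hGl : C ≤ N * G := by
    rw [hG]
    linarith [(abs_le.1 hp₀).2]
  have hGu : N * G ≤ 3 * C := by
    rw [hG]
    linarith [(abs_le.1 hp₀).1]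
  have hG0 : 0 < G := pos_of_mul_pos_right (hC.trans_le hGl) hN0.le
  have hδ : 3 * C / (N * Y) ≤ 3 * C / N := by
    gcongr
    nlinarith
  obtain ⟨α, hα, hroot⟩ := exists_cubic_root_near (Y := Y) (δ := 3 * C / (N * Y)) (by positivity)
    (hδ.trans ((div_le_one hN0).2 hNC)) (by
      have : |(p₂ : ℝ)| * (2 * |ξ| + 1) ≤ C * Y * (2 * |ξ| + 1) := by gcongr
      rw [hM] at hp₁l
      linarith) hG0.le (by
      have : 3 * C / (N * Y) * Y = 3 * C / N := by field_simp
      rw [this, le_div_iff₀ hN0]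
      linarith)
  have hne : 0 < |ξ - α| := by
    rw [abs_pos, sub_ne_zero]
    rintro rfl
    exact hG0.ne' hroot
  set Q := (⟨1, p₂, p₁, p₀⟩ : Cubic ℤ).toPoly with hQ
  have hQm : Q.Monic := Cubic.monic_of_a_eq_one rfl
  have hQα : aeval α Q = 0 := by
    simp only [hQ, Cubic.toPoly, map_add, map_mul, map_pow, aeval_X,
      map_one, one_mul, eq_intCast, map_intCast]
    exact hroot
  have hint : IsIntegral ℤ α := ⟨Q, hQm, hQα⟩
  have hPm := minpoly.monic hint
  have hdvd := minpoly.isIntegrallyClosed_dvd hint hQα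
  refine ⟨α, minpoly ℤ α, isMinIntPoly_minpoly hint, hPm, ?_, hne, hα, ?_⟩
  · exact (natDegree_le_of_dvd hdvd hQm.ne_zero).trans_eq
      (Cubic.natDegree_of_a_ne_zero one_ne_zero)
  · have hp₀' : |(p₀ : ℝ)| ≤ (3 * C + |ξ| ^ 3 + C * |ξ| ^ 2 + (M + C) * |ξ|) * Y := by
      have heq : (p₀ : ℝ) = G - ξ ^ 3 - p₂ * ξ ^ 2 - p₁ * ξ := by rw [hG]; ring
      have t₁ := abs_sub (G - ξ ^ 3 - p₂ * ξ ^ 2) (p₁ * ξ)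
      have t₂ := abs_sub (G - ξ ^ 3) (p₂ * ξ ^ 2)
      have t₃ := abs_sub G (ξ ^ 3)
      rw [← heq, abs_mul] at t₁
      rw [abs_mul, abs_pow] at t₂
      rw [abs_pow, abs_of_pos hG0] at t₃
      have b₁ : |(p₁ : ℝ)| * |ξ| ≤ (M + C) * Y * |ξ| := by gcongr
      have b₂ : |(p₂ : ℝ)| * |ξ| ^ 2 ≤ C * Y * |ξ| ^ 2 := by gcongr
      have b₃ : |ξ| ^ 3 * 1 ≤ |ξ| ^ 3 * Y := by gcongr
      have b₄ : G ≤ 3 * C * Y := by nlinarith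
      linarith
    refine (intPolyHeight_le_of_dvd_cubic hPm hdvd).trans ?_
    rw [hD]
    linarith

end MonicCubic

/-- Davenport–Schmidt theorem on approximation by cubic algebraic integers
(`α` is an algebraic integer iff its minimal integer polynomial is monic);
`γ = (1+√5)/2` is the Golden Ratio. -/
theorem davenport_schmidt_cubic_integers (ξ : ℝ)
    (hξ : ¬ ∃ Q : Polynomial ℚ, Q ≠ 0 ∧ Q.natDegree ≤ 2 ∧ Polynomial.aeval ξ Q = 0) :
    ∃ c : ℝ, 0 < c ∧
      {α : ℝ | ∃ P : Polynomial ℤ, IsMinIntPoly α P ∧ P.Monic ∧ P.natDegree ≤ 3 ∧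
        0 < |ξ - α| ∧
        |ξ - α| ≤ c * (intPolyHeight P : ℝ) ^ (-((1 + Real.sqrt 5) / 2) - 1)}.Infinite := by
  have hindep := int_quadratic_eq_zero hξ
  have h5 : √5 ^ 2 = (5 : ℝ) := Real.sq_sqrt (by norm_num)
  have h52 : 2 ≤ √(5 : ℝ) := Real.le_sqrt_of_sq_le (by norm_num)
  set γ := (1 + √5) / 2 with hγ
  have hγ1 : 1 < γ := by linarith
  set θ := γ - 1 with hθ
  have hθγ : θ * (γ + 1) = 1 + θ := by rw [hθ, hγ]; linarith
  obtain ⟨c, hc, hlow⟩ := exists_lower_bound_distNearestInt (θ := θ) (by linarith)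
    (by rw [hθ, hγ]; linarith) hindep
  obtain ⟨B, D, hB, hD, hnear⟩ := exists_cubic_integer_near ξ hc
  refine ⟨B * D ^ (γ + 1), by positivity, ?_⟩
  set S := {α : ℝ | ∃ P : Polynomial ℤ, IsMinIntPoly α P ∧ P.Monic ∧ P.natDegree ≤ 3 ∧
        0 < |ξ - α| ∧ |ξ - α| ≤ B * D ^ (γ + 1) * (intPolyHeight P : ℝ) ^ (-γ - 1)}
  suffices hdense : ∀ η : ℝ, 0 < η → ∃ α ∈ S, |ξ - α| < η by
    intro hfin
    obtain ⟨α₁, hα₁, -⟩ := hdense 1 one_pos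
    obtain ⟨α, hα, hmin⟩ := Set.exists_min_image S (fun α => |ξ - α|) hfin ⟨α₁, hα₁⟩
    obtain ⟨-, -, -, -, hpos, -⟩ := id hα
    obtain ⟨β, hβ, hlt⟩ := hdense _ hpos
    exact absurd (hmin β hβ) (not_le.2 hlt)
  intro η hη
  obtain ⟨N₀, hN₀⟩ := exists_nat_gt (max B (B / η))
  obtain ⟨N, hN, hN1, hbad⟩ := hlow N₀
  have hNR : (N₀ : ℝ) ≤ N := by exact_mod_cast hN
  have hN1' : (1 : ℝ) ≤ N := by exact_mod_cast hN1
  have hN0 : (0 : ℝ) < N := by linarith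
  have hNB : B ≤ N := ((le_max_left _ _).trans hN₀.le).trans hNR
  have hNη : B / η < N := ((le_max_right _ _).trans_lt hN₀).trans_le hNR
  set Y := (N : ℝ) ^ θ with hYdef
  have hY1 : 1 ≤ Y := Real.one_le_rpow hN1' (by linarith)
  have hY0 : 0 < Y := by linarith
  have hNY : N * Y = Y ^ (γ + 1) := by
    rw [hYdef, ← Real.rpow_mul hN0.le, hθγ, Real.rpow_add hN0, Real.rpow_one]
  obtain ⟨α, P, hmin, hP, hdeg, hne, hα, hH⟩ := hnear N Y hN1' hNB hY1 (by
    intro x₀ x₁ x₂ hx₀ hx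
    have hb := hbad x₀.natAbs (by omega) (by
      rw [← Int.cast_abs, Int.abs_eq_natAbs] at hx
      exact_mod_cast hx)
    rw [Real.rpow_neg hN0.le, ← hYdef] at hb
    have hcY : c ≤ Y * distNearestInt ξ x₀.natAbs := by
      have := mul_le_mul_of_nonneg_left hb hY0.le
      rwa [mul_left_comm, mul_inv_cancel₀ hY0.ne', mul_one] at this
    rcases distNearestInt_le ξ x₀ x₁ x₂ with h | h
    · exact Or.inl (hcY.trans (by gcongr))
    · exact Or.inr (hcY.trans (by gcongr)))
  refine ⟨α, ⟨P, hmin, hP, hdeg, hne, ?_⟩, ?_⟩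
  · have hH1 : (1 : ℝ) ≤ intPolyHeight P := by exact_mod_cast one_le_intPolyHeight hP
    calc |ξ - α| ≤ B / (N * Y) := hα
      _ = B * D ^ (γ + 1) * (D * Y) ^ (-(γ + 1)) := by
        rw [hNY, Real.rpow_neg (by positivity), Real.mul_rpow hD.le hY0.le]
        field_simp
      _ ≤ B * D ^ (γ + 1) * (intPolyHeight P : ℝ) ^ (-(γ + 1)) :=
        mul_le_mul_of_nonneg_left
          (Real.rpow_le_rpow_of_nonpos (by linarith) hH (by linarith)) (by positivity)
      _ = _ := by rw [neg_add, sub_eq_add_neg]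
  · refine lt_of_le_of_lt (hα.trans ?_) ((div_lt_comm₀ hη hN0).1 hNη)
    gcongr
    exact le_mul_of_one_le_right hN0.le hY1
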